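/- arXiv:1301.4623 — 2 statements merged into one kernel-verified Lean document; each statement's English description precedes it below -/
import Mathlib

section
/- Let n = 4r + q with r ≥ 1 and 0 ≤ q ≤ 3. Then f(n; κ̄₄ = 1) equals (3n − 2)/2 if q = 0, (3n − 3)/2 if q = 1, (3n − 4)/2 if q = 2, and (3n − 3)/2 if q = 3; that is, the maximum number of edges of a connected graph G on n vertices with κ̄₄(G) = 1 equals the stated value, and in particular this maximum is attained by some such graph. -/
open SimpleGraph

/-- An `S`-Steiner tree in `G`: a subgraph that is a tree and contains `S`. -/
def SimpleGraph.IsSteinerTree {V : Type*} (G : SimpleGraph V) (S : Set V)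
    (T : G.Subgraph) : Prop :=
  S ⊆ T.verts ∧ T.coe.IsTree

/-- `κ(S)`: the maximum number of pairwise internally disjoint `S`-Steiner trees in `G`. -/
noncomputable def SimpleGraph.steinerConn {V : Type*} (G : SimpleGraph V) (S : Set V) : ℕ :=
  sSup {n : ℕ | ∃ f : Fin n → G.Subgraph,
    (∀ i, G.IsSteinerTree S (f i)) ∧
    ∀ i j, i ≠ j →
      (f i).edgeSet ∩ (f j).edgeSet = ∅ ∧ (f i).verts ∩ (f j).verts = S}

/-- `κ̄ₖ(G) = max {κ(S) : S ⊆ V(G), |S| = k}`, the maximal generalized local connectivity. -/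
noncomputable def SimpleGraph.kappaBar {V : Type*} (G : SimpleGraph V) (k : ℕ) : ℕ :=
  sSup {m : ℕ | ∃ S : Finset V, S.card = k ∧ G.steinerConn ↑S = m}

/-- `p` is an ear of the cycle `c` in `G`: a nontrivial path (whose two endpoints may
coincide) meeting `c` exactly in its endpoints. -/
def SimpleGraph.IsEar {V : Type*} (G : SimpleGraph V) {x u v : V}
    (c : G.Walk x x) (p : G.Walk u v) : Prop :=
  0 < p.length ∧ u ∈ c.support ∧ v ∈ c.support ∧
  p.support.tail.Nodup ∧ (u = v ∨ u ∉ p.support.tail) ∧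
  ∀ w ∈ p.support, w ∈ c.support → w = u ∨ w = v

namespace SimpleGraph

variable {V : Type*} {G : SimpleGraph V}

lemma Subgraph.Connected.sup_of_mem {H K : G.Subgraph} (hH : H.Connected) (hK : K.Connected)
    {z : V} (hz : z ∈ H.verts) (hz' : z ∈ K.verts) : (H ⊔ K).Connected :=
  Subgraph.connected_sup hH.preconnected hK.preconnected ⟨z, hz, hz'⟩

/-- Two internally disjoint connected subgraphs of `G` whose common vertices are exactly `S`. -/
structure SteinerPair (S : Set V) (T₁ T₂ : G.Subgraph) : Prop where
  conn₁ : T₁.Connected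
  conn₂ : T₂.Connected
  edges : ∀ a b, T₁.Adj a b → ¬ T₂.Adj a b
  verts : ∀ z, z ∈ S ↔ z ∈ T₁.verts ∧ z ∈ T₂.verts

lemma SteinerPair.symm {S : Set V} {T₁ T₂ : G.Subgraph} (h : SteinerPair S T₁ T₂) :
    SteinerPair S T₂ T₁ :=
  ⟨h.conn₂, h.conn₁, fun a b h₂ h₁ => h.edges a b h₁ h₂, fun z => (h.verts z).trans and_comm⟩

/-- A subgraph behaving like a path from `x` to `y`: it can be cut at each of its vertices. -/
structure IsArc (P : G.Subgraph) (x y : V) : Prop where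
  conn : P.Connected
  left : x ∈ P.verts
  right : y ∈ P.verts
  split : ∀ c ∈ P.verts, ∃ A B : G.Subgraph, A ⊔ B = P ∧ A.Connected ∧ B.Connected ∧
    x ∈ A.verts ∧ c ∈ A.verts ∧ c ∈ B.verts ∧ y ∈ B.verts ∧ ∀ z ∈ A.verts, z ∈ B.verts → z = c
  adj_of_short : (∀ z ∈ P.verts, z = x ∨ z = y) → P.Adj x y

lemma IsArc.symm {P : G.Subgraph} {x y : V} (h : IsArc P x y) : IsArc P y x where
  conn := h.conn
  left := h.right
  right := h.left
  split c hc := by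
    obtain ⟨A, B, h1, h3, h4, h5, h6, h7, h8, h9⟩ := h.split c hc
    exact ⟨B, A, sup_comm B A ▸ h1, h4, h3, h8, h7, h6, h5, fun z hz hz' => h9 z hz' hz⟩
  adj_of_short hs := (h.adj_of_short fun z hz => (hs z hz).symm).symm

lemma Walk.IsPath.isArc {x y : V} {p : G.Walk x y} (hp : p.IsPath) (hxy : x ≠ y) :
    IsArc p.toSubgraph x y where
  conn := p.toSubgraph_connected
  left := p.start_mem_verts_toSubgraph
  right := p.end_mem_verts_toSubgraph
  split c hc := by
    classical
    have hc' := p.mem_verts_toSubgraph.1 hc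
    have key : (p.takeUntil c hc').toSubgraph ⊔ (p.dropUntil c hc').toSubgraph
        = p.toSubgraph := by
      rw [← Walk.toSubgraph_append, Walk.take_spec]
    refine ⟨(p.takeUntil c hc').toSubgraph, (p.dropUntil c hc').toSubgraph,
      key, Walk.toSubgraph_connected _,
      Walk.toSubgraph_connected _, by simp, by simp, by simp, by simp, ?_⟩
    intro z hz hz'
    rw [Walk.mem_verts_toSubgraph] at hz hz'
    have hn := hp.support_nodup
    rw [← p.take_spec hc', Walk.support_append] at hn
    have hd := List.disjoint_of_nodup_append hn hz
    by_contra hne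
    rw [← Walk.cons_tail_support] at hz'
    exact hd ((List.mem_cons.1 hz').resolve_left hne)
  adj_of_short hs := by
    cases p with
    | nil => exact absurd rfl hxy
    | @cons _ w _ h q =>
      have hw : w = x ∨ w = y := hs w (by simp)
      rcases hw with rfl | rfl
      · exact absurd rfl h.ne
      · simp

lemma Walk.IsCycle.exists_arcs_start {a b : V} {c : G.Walk a a} (hc : c.IsCycle)
    (hb : b ∈ c.support) (hab : a ≠ b) : ∃ P Q : G.Subgraph, IsArc P a b ∧ IsArc Q a b ∧
      P ⊔ Q = c.toSubgraph ∧ (∀ z ∈ P.verts, z ∈ Q.verts → z = a ∨ z = b) ∧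
      ∀ s t, P.Adj s t → ¬ Q.Adj s t := by
  classical
  have key : (c.takeUntil b hb).toSubgraph ⊔ (c.dropUntil b hb).toSubgraph
      = c.toSubgraph := by
    rw [← Walk.toSubgraph_append, Walk.take_spec]
  have hq : (c.dropUntil b hb).IsPath := by
    have h := hc
    rw [← c.take_spec hb] at h
    exact h.isPath_of_append_right (Walk.not_nil_of_ne hab)
  refine ⟨(c.takeUntil b hb).toSubgraph, (c.dropUntil b hb).toSubgraph,
    (hc.isPath_takeUntil hb).isArc hab, (hq.isArc hab.symm).symm, key, ?_, ?_⟩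
  · intro z hz hz'
    rw [Walk.mem_verts_toSubgraph] at hz hz'
    have hn := hc.support_nodup
    rw [← c.take_spec hb, Walk.tail_support_append] at hn
    have hd := List.disjoint_of_nodup_append hn
    rw [← Walk.cons_tail_support] at hz hz'
    rcases List.mem_cons.1 hz with h | h
    · exact Or.inl h
    · rcases List.mem_cons.1 hz' with h' | h'
      · exact Or.inr h'
      · exact (hd h h').elim
  · intro s t h h'
    rw [Walk.adj_toSubgraph_iff_mem_edges] at h h'
    exact hc.isTrail.disjoint_edges_takeUntil_dropUntil hb h h'

lemma Walk.IsCycle.exists_arcs {u a b : V} {c : G.Walk u u} (hc : c.IsCycle)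
    (ha : a ∈ c.support) (hb : b ∈ c.support) (hab : a ≠ b) :
    ∃ P Q : G.Subgraph, IsArc P a b ∧ IsArc Q a b ∧
      P ⊔ Q = c.toSubgraph ∧ (∀ z ∈ P.verts, z ∈ Q.verts → z = a ∨ z = b) ∧
      ∀ s t, P.Adj s t → ¬ Q.Adj s t := by
  classical
  have := (hc.rotate ha).exists_arcs_start (b := b) (by simpa using hb) hab
  simpa using this

/-- `H` is the union of two internally disjoint `S`-Steiner subgraphs. -/
def Splits (H : G.Subgraph) (S : Set V) : Prop :=
  ∃ T₁ T₂ : G.Subgraph, T₁ ⊔ T₂ = H ∧ SteinerPair S T₁ T₂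

lemma Walk.IsCycle.splits {u a b : V} {c : G.Walk u u} (hc : c.IsCycle)
    (ha : a ∈ c.support) (hb : b ∈ c.support) (hab : a ≠ b) : Splits c.toSubgraph {a, b} := by
  obtain ⟨P, Q, hP, hQ, hs, hv, he⟩ := hc.exists_arcs ha hb hab
  refine ⟨P, Q, hs, hP.conn, hQ.conn, he, fun z => ?_⟩
  refine ⟨?_, fun h => hv z h.1 h.2⟩
  rintro (rfl | rfl)
  · exact ⟨hP.left, hQ.left⟩
  · exact ⟨hP.right, hQ.right⟩

/-- Attaching a cycle at a terminal yields a new terminal anywhere on that cycle. -/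
lemma Splits.attach_cycle {S : Set V} {H : G.Subgraph} (h : Splits H S) {u w : V}
    {c : G.Walk u u} (hc : c.IsCycle) (hu : u ∈ S) (hcH : ∀ z ∈ c.support, z ∈ H.verts → z = u)
    (hw : w ∈ c.support) (hwu : w ≠ u) : Splits (H ⊔ c.toSubgraph) (insert w S) := by
  obtain ⟨T₁, T₂, rfl, h⟩ := h
  obtain ⟨P, Q, hc', hPQ⟩ := hc.splits c.start_mem_support hw hwu.symm
  have hu' := (h.verts u).1 hu
  have huP := (hPQ.verts u).1 (by simp)
  have hc'' : ∀ z, z ∈ c.support ↔ z ∈ P.verts ∨ z ∈ Q.verts := fun z => by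
    rw [← Walk.mem_verts_toSubgraph, ← hc']; rfl
  have hwP := (hPQ.verts w).1 (by simp)
  simp only [Subgraph.verts_sup, Set.mem_union] at hcH
  refine ⟨T₁ ⊔ P, T₂ ⊔ Q, by rw [← hc', sup_sup_sup_comm],
    h.conn₁.sup_of_mem hPQ.conn₁ hu'.1 huP.1, h.conn₂.sup_of_mem hPQ.conn₂ hu'.2 huP.2, ?_, ?_⟩
  · intro a b
    simp only [Subgraph.sup_adj]
    rintro (hab | hab) (hab' | hab')
    · exact h.edges a b hab hab'
    · have ha := hcH a ((hc'' a).2 (Or.inr hab'.fst_mem)) (Or.inl hab.fst_mem)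
      have hb := hcH b ((hc'' b).2 (Or.inr hab'.snd_mem)) (Or.inl hab.snd_mem)
      exact hab.ne (ha.trans hb.symm)
    · have ha := hcH a ((hc'' a).2 (Or.inl hab.fst_mem)) (Or.inr hab'.fst_mem)
      have hb := hcH b ((hc'' b).2 (Or.inl hab.snd_mem)) (Or.inr hab'.snd_mem)
      exact hab.ne (ha.trans hb.symm)
    · exact hPQ.edges a b hab hab'
  · intro z
    have e1 := h.verts z
    have e2 := hPQ.verts z
    have e3 := hcH z
    have e4 := hc'' z
    simp only [Subgraph.verts_sup, Set.mem_union, Set.mem_insert_iff,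
      Set.mem_singleton_iff] at *
    grind

/-- Attaching a connected subgraph `P` that joins a non-terminal `u` to a terminal `v`
turns `u` into a terminal. -/
lemma Splits.attach_ear {S : Set V} {H P : G.Subgraph} (h : Splits H S) {u v : V}
    (hP : P.Connected) (huP : u ∈ P.verts) (hvP : v ∈ P.verts)
    (hPH : ∀ z ∈ P.verts, z ∈ H.verts → z = u ∨ z = v)
    (hPe : ∀ a b, P.Adj a b → ¬ H.Adj a b) (hu : u ∈ H.verts) (hv : v ∈ S) :
    Splits (H ⊔ P) (insert u S) := by
  obtain ⟨T₁, T₂, rfl, h⟩ := h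
  wlog hu₁ : u ∈ T₁.verts generalizing T₁ T₂
  · have hu₂ := hu.resolve_left hu₁
    rw [sup_comm T₁] at hPH hPe hu ⊢
    exact this T₂ T₁ h.symm hPH hPe hu hu₂
  refine ⟨T₁, T₂ ⊔ P, (sup_assoc ..).symm, h.conn₁,
    h.conn₂.sup_of_mem hP ((h.verts v).1 hv).2 hvP, ?_, ?_⟩
  · intro a b hab
    simp only [Subgraph.sup_adj]
    rintro (hab' | hab')
    · exact h.edges a b hab hab'
    · exact hPe a b hab' (Or.inl hab)
  · intro z
    have e1 := h.verts z
    have e2 := h.verts v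
    have e3 := hPH z
    simp only [Subgraph.verts_sup, Set.mem_union, Set.mem_insert_iff] at *
    grind

/-- Every vertex is a terminal of some splitting with three terminals, and any two vertices are
separated by the terminal set of such a splitting. -/
structure IsRich (H : G.Subgraph) : Prop where
  mem : ∀ u ∈ H.verts, ∃ S, S.ncard = 3 ∧ Splits H S ∧ u ∈ S
  separate : ∀ u ∈ H.verts, ∀ v ∈ H.verts, u ≠ v →
    ∃ S, S.ncard = 3 ∧ Splits H S ∧ (u ∉ S ∧ v ∈ S ∨ v ∉ S ∧ u ∈ S)

lemma Walk.IsCycle.exists_other {u v : V} {c : G.Walk u u} (hc : c.IsCycle) :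
    ∃ w ∈ c.support, w ≠ u ∧ w ≠ v := by
  classical
  have hcard : ({u, v} : Finset V).card < c.support.tail.toFinset.card := by
    rw [List.toFinset_card_of_nodup hc.support_nodup, List.length_tail, Walk.length_support]
    have := hc.three_le_length
    have := Finset.card_le_two (a := u) (b := v)
    omega
  obtain ⟨w, hw, hw'⟩ := Finset.exists_mem_notMem_of_card_lt_card hcard
  exact ⟨w, List.mem_of_mem_tail (List.mem_toFinset.1 hw), by simpa using hw'⟩

lemma isRich_of_two_cycles {x : V} {c d : G.Walk x x} (hc : c.IsCycle) (hd : d.IsCycle)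
    (hcd : ∀ z ∈ c.support, z ∈ d.support → z = x) :
    IsRich (c.toSubgraph ⊔ d.toSubgraph) := by
  have key : ∀ a ∈ c.support, a ≠ x → ∀ b ∈ d.support, b ≠ x →
      ({b, x, a} : Set V).ncard = 3 ∧ Splits (c.toSubgraph ⊔ d.toSubgraph) {b, x, a} := by
    intro a ha hax b hb hbx
    refine ⟨Set.ncard_eq_three.2 ⟨b, x, a, hbx, fun h => hax ?_, hax.symm, rfl⟩, ?_⟩
    · exact hcd a ha (h ▸ hb)
    · exact (hc.splits c.start_mem_support ha hax.symm).attach_cycle hd (by simp)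
        (fun z hz hz' => hcd z (c.mem_verts_toSubgraph.1 hz') hz) hb hbx
  have other : ∀ v, (∃ w ∈ c.support, w ≠ x ∧ w ≠ v) ∧ (∃ w ∈ d.support, w ≠ x ∧ w ≠ v) :=
    fun v => ⟨hc.exists_other, hd.exists_other⟩
  have hx := c.start_mem_support
  have hx' := d.start_mem_support
  constructor
  · intro u hu
    simp only [Subgraph.verts_sup, Set.mem_union, Walk.mem_verts_toSubgraph] at hu
    obtain ⟨⟨a, ha, hax, -⟩, b, hb, hbx, -⟩ := other x
    by_cases hux : u = x
    · exact ⟨_, (key a ha hax b hb hbx).1, (key a ha hax b hb hbx).2, by simp [hux]⟩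
    rcases hu with hu | hu
    · exact ⟨_, (key u hu hux b hb hbx).1, (key u hu hux b hb hbx).2, by simp⟩
    · exact ⟨_, (key a ha hax u hu hux).1, (key a ha hax u hu hux).2, by simp⟩
  · have aux : ∀ u ∈ (c.toSubgraph ⊔ d.toSubgraph).verts,
        ∀ v ∈ (c.toSubgraph ⊔ d.toSubgraph).verts, u ≠ v → v ≠ x →
        ∃ S, S.ncard = 3 ∧ Splits (c.toSubgraph ⊔ d.toSubgraph) S ∧ v ∉ S ∧ u ∈ S := by
      intro u hu v hv huv hvx
      simp only [Subgraph.verts_sup, Set.mem_union, Walk.mem_verts_toSubgraph] at hu hv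
      obtain ⟨⟨a, ha, hax, hav⟩, b, hb, hbx, hbv⟩ := other v
      by_cases hux : u = x
      · exact ⟨_, (key a ha hax b hb hbx).1, (key a ha hax b hb hbx).2, by grind, by grind⟩
      rcases hu with hu | hu
      · exact ⟨_, (key u hu hux b hb hbx).1, (key u hu hux b hb hbx).2, by grind, by grind⟩
      · exact ⟨_, (key a ha hax u hu hux).1, (key a ha hax u hu hux).2, by grind, by grind⟩
    intro u hu v hv huv
    by_cases hvx : v = x
    · obtain ⟨S, h1, h2, h3⟩ := aux v hv u hu huv.symm (fun h => huv (h.trans hvx.symm))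
      exact ⟨S, h1, h2, Or.inl h3⟩
    · obtain ⟨S, h1, h2, h3⟩ := aux u hu v hv huv hvx
      exact ⟨S, h1, h2, Or.inr h3⟩

/-- Three internally disjoint arcs from `x` to `y`. -/
structure IsTheta (P Q R : G.Subgraph) (x y : V) : Prop where
  ne : x ≠ y
  arc₁ : IsArc P x y
  arc₂ : IsArc Q x y
  arc₃ : IsArc R x y
  inter₁₂ : ∀ z ∈ P.verts, z ∈ Q.verts → z = x ∨ z = y
  inter₁₃ : ∀ z ∈ P.verts, z ∈ R.verts → z = x ∨ z = y
  inter₂₃ : ∀ z ∈ Q.verts, z ∈ R.verts → z = x ∨ z = y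
  edges₁₂ : ∀ a b, P.Adj a b → ¬ Q.Adj a b
  edges₁₃ : ∀ a b, P.Adj a b → ¬ R.Adj a b
  edges₂₃ : ∀ a b, Q.Adj a b → ¬ R.Adj a b

namespace IsTheta

variable {P Q R : G.Subgraph} {x y : V}

lemma rotate (h : IsTheta P Q R x y) : IsTheta Q R P x y :=
  ⟨h.ne, h.arc₂, h.arc₃, h.arc₁, h.inter₂₃, fun z h₁ h₂ => h.inter₁₂ z h₂ h₁,
    fun z h₁ h₂ => h.inter₁₃ z h₂ h₁, h.edges₂₃,
    fun a b h₁ h₂ => h.edges₁₂ a b h₂ h₁, fun a b h₁ h₂ => h.edges₁₃ a b h₂ h₁⟩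

lemma sup_rotate (P Q R : G.Subgraph) : Q ⊔ R ⊔ P = P ⊔ Q ⊔ R := by
  rw [sup_comm, sup_assoc]

/-- Both branch vertices and one inner vertex as terminals. -/
lemma splits_branch (h : IsTheta P Q R x y) {c : V} (hc : c ∈ P.verts) :
    Splits (P ⊔ Q ⊔ R) {x, y, c} := by
  obtain ⟨A, B, rfl, hA, hB, hxA, hcA, hcB, hyB, hAB⟩ := h.arc₁.split c hc
  refine ⟨A ⊔ Q, B ⊔ R, by simp only [sup_assoc, sup_left_comm],
    hA.sup_of_mem h.arc₂.conn hxA h.arc₂.left, hB.sup_of_mem h.arc₃.conn hyB h.arc₃.right, ?_, ?_⟩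
  · intro a b
    have e1 := h.edges₁₂ a b
    have e2 := h.edges₁₃ a b
    have e3 := h.edges₂₃ a b
    have e4 : A.Adj a b → ¬ B.Adj a b := fun h₁ h₂ => h₁.ne
      ((hAB a h₁.fst_mem h₂.fst_mem).trans (hAB b h₁.snd_mem h₂.snd_mem).symm)
    simp only [Subgraph.sup_adj] at *
    tauto
  · intro z
    have e1 := h.inter₁₂ z
    have e2 := h.inter₁₃ z
    have e3 := h.inter₂₃ z
    have e4 := hAB z
    have e5 := h.arc₂.left
    have e6 := h.arc₃.left
    have e7 := h.arc₂.right
    have e8 := h.arc₃.right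
    have e9 := h.ne
    simp only [Subgraph.verts_sup, Set.mem_union, Set.mem_insert_iff,
      Set.mem_singleton_iff] at *
    grind

/-- One branch vertex and two inner vertices of different arcs as terminals. -/
lemma splits_inner (h : IsTheta P Q R x y) {c d : V} (hc : c ∈ P.verts) (hcy : c ≠ y)
    (hd : d ∈ Q.verts) (hdy : d ≠ y) :
    Splits (P ⊔ Q ⊔ R) {x, c, d} := by
  obtain ⟨A, B, rfl, hA, hB, hxA, hcA, hcB, hyB, hAB⟩ := h.arc₁.split c hc
  obtain ⟨A', B', rfl, hA', hB', hxA', hdA', hdB', hyB', hAB'⟩ := h.arc₂.split d hd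
  refine ⟨A ⊔ A', (B ⊔ B') ⊔ R, by rw [← sup_assoc, sup_sup_sup_comm],
    hA.sup_of_mem hA' hxA hxA', (hB.sup_of_mem hB' hyB hyB').sup_of_mem h.arc₃.conn
      (Or.inl hyB) h.arc₃.right, ?_, ?_⟩
  · intro a b
    have e1 := h.edges₁₂ a b
    have e1' := h.edges₁₂ a b
    have e2 := h.edges₁₃ a b
    have e3 := h.edges₂₃ a b
    have e4 : A.Adj a b → ¬ B.Adj a b := fun h₁ h₂ => h₁.ne
      ((hAB a h₁.fst_mem h₂.fst_mem).trans (hAB b h₁.snd_mem h₂.snd_mem).symm)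
    have e5 : A'.Adj a b → ¬ B'.Adj a b := fun h₁ h₂ => h₁.ne
      ((hAB' a h₁.fst_mem h₂.fst_mem).trans (hAB' b h₁.snd_mem h₂.snd_mem).symm)
    simp only [Subgraph.sup_adj] at *
    tauto
  · intro z
    have e1 := h.inter₁₂ z
    have e2 := h.inter₁₃ z
    have e3 := h.inter₂₃ z
    have e4 := hAB z
    have e4' := hAB' z
    have e5 := hAB y
    have e5' := hAB' y
    have e6 := h.arc₃.left
    have e9 := h.ne
    have e10 := hAB x
    have e10' := hAB' x
    simp only [Subgraph.verts_sup, Set.mem_union, Set.mem_insert_iff,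
      Set.mem_singleton_iff] at *
    grind

lemma isRich_of_inner (h : IsTheta P Q R x y) (hP : ∃ c ∈ P.verts, c ≠ x ∧ c ≠ y)
    (hQ : ∃ c ∈ Q.verts, c ≠ x ∧ c ≠ y) : IsRich (P ⊔ Q ⊔ R) := by
  have key : ∀ c ∈ (P ⊔ Q ⊔ R).verts, c ≠ x → c ≠ y →
      ({x, y, c} : Set V).ncard = 3 ∧ Splits (P ⊔ Q ⊔ R) {x, y, c} := by
    intro c hc hcx hcy
    refine ⟨Set.ncard_eq_three.2 ⟨x, y, c, h.ne, hcx.symm, hcy.symm, rfl⟩, ?_⟩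
    rcases hc with (hc | hc) | hc
    · exact h.splits_branch hc
    · exact sup_rotate P Q R ▸ h.rotate.splits_branch hc
    · rw [← sup_rotate P Q R, ← sup_rotate Q R P]
      exact h.rotate.rotate.splits_branch hc
  obtain ⟨a, ha, hax, hay⟩ := hP
  obtain ⟨b, hb, hbx, hby⟩ := hQ
  have hab : a ≠ b := by
    rintro rfl
    exact (h.inter₁₂ a ha hb).elim hax hay
  have haH : a ∈ (P ⊔ Q ⊔ R).verts := Or.inl (Or.inl ha)
  have hbH : b ∈ (P ⊔ Q ⊔ R).verts := Or.inl (Or.inr hb)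
  have hxy := h.ne
  constructor
  · intro u hu
    by_cases huxy : u = x ∨ u = y
    · exact ⟨_, (key a haH hax hay).1, (key a haH hax hay).2, by grind⟩
    · push Not at huxy
      exact ⟨_, (key u hu huxy.1 huxy.2).1, (key u hu huxy.1 huxy.2).2, by grind⟩
  · have aux : ∀ u ∈ (P ⊔ Q ⊔ R).verts, ∀ v ∈ (P ⊔ Q ⊔ R).verts, u ≠ v → v ≠ x → v ≠ y →
        ∃ S, S.ncard = 3 ∧ Splits (P ⊔ Q ⊔ R) S ∧ v ∉ S ∧ u ∈ S := by
      intro u hu v hv huv hvx hvy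
      by_cases huxy : u = x ∨ u = y
      · by_cases hav : a = v
        · exact ⟨_, (key b hbH hbx hby).1, (key b hbH hbx hby).2, by grind, by grind⟩
        · exact ⟨_, (key a haH hax hay).1, (key a haH hax hay).2, by grind, by grind⟩
      · push Not at huxy
        exact ⟨_, (key u hu huxy.1 huxy.2).1, (key u hu huxy.1 huxy.2).2, by grind, by grind⟩
    intro u hu v hv huv
    by_cases hv' : v = x ∨ v = y
    · by_cases hu' : u = x ∨ u = y
      · refine ⟨{x, a, b}, Set.ncard_eq_three.2 ⟨x, a, b, hax.symm, hbx.symm, hab, rfl⟩,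
          h.splits_inner ha hay hb hby, ?_⟩
        grind
      · push Not at hu'
        obtain ⟨S, h1, h2, h3⟩ := aux v hv u hu huv.symm hu'.1 hu'.2
        exact ⟨S, h1, h2, Or.inl h3⟩
    · push Not at hv'
      obtain ⟨S, h1, h2, h3⟩ := aux u hu v hv huv hv'.1 hv'.2
      exact ⟨S, h1, h2, Or.inr h3⟩

lemma isRich (h : IsTheta P Q R x y) : IsRich (P ⊔ Q ⊔ R) := by
  have short : ∀ {T : G.Subgraph}, IsArc T x y → (¬ ∃ c ∈ T.verts, c ≠ x ∧ c ≠ y) →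
      T.Adj x y := by
    intro T hT hn
    refine hT.adj_of_short fun z hz => ?_
    by_contra! hz'
    exact hn ⟨z, hz, hz'⟩
  by_cases hP : ∃ c ∈ P.verts, c ≠ x ∧ c ≠ y
  · by_cases hQ : ∃ c ∈ Q.verts, c ≠ x ∧ c ≠ y
    · exact h.isRich_of_inner hP hQ
    · by_cases hR : ∃ c ∈ R.verts, c ≠ x ∧ c ≠ y
      · rw [← sup_rotate P Q R, ← sup_rotate Q R P]
        exact h.rotate.rotate.isRich_of_inner hR hP
      · exact absurd (short h.arc₃ hR) (h.edges₂₃ x y (short h.arc₂ hQ))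
  · by_cases hQ : ∃ c ∈ Q.verts, c ≠ x ∧ c ≠ y
    · by_cases hR : ∃ c ∈ R.verts, c ≠ x ∧ c ≠ y
      · rw [← sup_rotate P Q R]
        exact h.rotate.isRich_of_inner hQ hR
      · exact absurd (short h.arc₃ hR) (h.edges₁₃ x y (short h.arc₁ hP))
    · exact absurd (short h.arc₂ hQ) (h.edges₁₂ x y (short h.arc₁ hP))

end IsTheta

/-- A walk attached to `H` along its two endpoints only, increasing the cyclomatic number of `H`
by at most one. -/
structure IsHandle (H : G.Subgraph) {u v : V} (p : G.Walk u v) : Prop where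
  left : u ∈ H.verts
  right : v ∈ H.verts
  inter : ∀ z ∈ p.support, z ∈ H.verts → z = u ∨ z = v
  edges : ∀ a b, p.toSubgraph.Adj a b → ¬ H.Adj a b
  excess : (H ⊔ p.toSubgraph).edgeSet.ncard + H.verts.ncard ≤
    H.edgeSet.ncard + (H ⊔ p.toSubgraph).verts.ncard + 1

lemma isHandle_cons [Finite V] {H : G.Subgraph} {u w v : V} (h : G.Adj u w) {q : G.Walk w v}
    (hq : q.IsPath) (hu : u ∈ H.verts) (hv : v ∈ H.verts) (huw : ¬ H.Adj u w)
    (hqH : ∀ z ∈ q.support, z ∈ H.verts → z = v) : IsHandle H (Walk.cons h q) where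
  left := hu
  right := hv
  inter z hz hzH := by
    rw [Walk.support_cons, List.mem_cons] at hz
    exact hz.imp_right fun hz => hqH z hz hzH
  edges a b hab habH := by
    rw [Walk.adj_toSubgraph_iff_mem_edges, Walk.edges_cons, List.mem_cons] at hab
    rcases hab with hab | hab
    · rcases Sym2.eq_iff.1 hab with ⟨rfl, rfl⟩ | ⟨rfl, rfl⟩
      · exact huw habH
      · exact huw habH.symm
    · have ha := hqH a (q.fst_mem_support_of_mem_edges hab) habH.fst_mem
      have hb := hqH b (q.snd_mem_support_of_mem_edges hab) habH.snd_mem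
      exact habH.ne (ha.trans hb.symm)
  excess := by
    classical
    have h₁ : (H ⊔ (Walk.cons h q).toSubgraph).edgeSet.ncard ≤
        H.edgeSet.ncard + (q.length + 1) := by
      rw [Subgraph.edgeSet_sup]
      refine (Set.ncard_union_le _ _).trans (Nat.add_le_add_left ?_ _)
      have : (Walk.cons h q).toSubgraph.edgeSet = ((Walk.cons h q).edges.toFinset : Set (Sym2 V)) := by
        ext e
        simp only [Walk.mem_edges_toSubgraph, List.coe_toFinset, Set.mem_ofPred_eq]
      rw [this, Set.ncard_coe_finset]
      refine (List.toFinset_card_le _).trans ?_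
      simp
    have h₂ : H.verts.ncard + q.length ≤ (H ⊔ (Walk.cons h q).toSubgraph).verts.ncard := by
      have hc : ((q.support.toFinset.erase v : Finset V) : Set V).ncard = q.length := by
        rw [Set.ncard_coe_finset, Finset.card_erase_of_mem (by simp),
          List.toFinset_card_of_nodup hq.support_nodup, Walk.length_support, Nat.add_sub_cancel]
      rw [← hc, ← Set.ncard_union_eq]
      · refine Set.ncard_le_ncard ?_
        rintro z (hz | hz)
        · exact Or.inl hz
        · refine Or.inr ?_
          rw [Walk.mem_verts_toSubgraph]
          simp only [Finset.coe_erase, List.coe_toFinset] at hz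
          exact List.mem_cons_of_mem _ hz.1
      · rw [Set.disjoint_left]
        intro z hz hz'
        simp only [Finset.coe_erase, List.coe_toFinset] at hz'
        exact hz'.2 (hqH z hz'.1 hz)
    omega

lemma Connected.exists_adj_notMem_subgraph [Finite V] (hG : G.Connected) {H : G.Subgraph}
    (hH : H.verts.Nonempty) (hlt : H.edgeSet.ncard < G.edgeSet.ncard) :
    ∃ u ∈ H.verts, ∃ w, G.Adj u w ∧ ¬ H.Adj u w := by
  by_cases hall : ∀ z, z ∈ H.verts
  · by_contra! hcon
    refine hlt.not_ge (Set.ncard_le_ncard fun e => ?_)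
    induction e with
    | h a b => exact fun hab => hcon a (hall a) b hab
  · push Not at hall
    obtain ⟨z, hz⟩ := hall
    obtain ⟨x, hx⟩ := hH
    obtain ⟨p⟩ := hG.preconnected x z
    obtain ⟨d, -, hd, hd'⟩ := p.exists_boundary_dart H.verts hx hz
    exact ⟨d.fst, hd, d.snd, d.adj, fun h => hd' h.snd_mem⟩

lemma Connected.exists_isHandle [Finite V] (hG : G.Connected)
    (hbr : ∀ u v, G.Adj u v → ¬ G.IsBridge s(u, v)) {H : G.Subgraph}
    (hH : H.verts.Nonempty) (hlt : H.edgeSet.ncard < G.edgeSet.ncard) :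
    (∃ (u v : V) (p : G.Walk u v), u ≠ v ∧ p.IsPath ∧ IsHandle H p) ∨
      ∃ (u : V) (c : G.Walk u u), c.IsCycle ∧ IsHandle H c := by
  classical
  cases nonempty_fintype V
  obtain ⟨u, hu, w, huw, huw'⟩ := hG.exists_adj_notMem_subgraph hH hlt
  have hb := hbr u w huw
  rw [isBridge_iff_forall_walk_mem_edges] at hb
  push Not at hb
  obtain ⟨p₀, hp₀⟩ := hb
  have hp : s(u, w) ∉ p₀.bypass.reverse.edges := by
    rw [Walk.edges_reverse, List.mem_reverse]
    exact fun h => hp₀ (p₀.edges_bypass_subset_edges h)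
  have hp' : p₀.bypass.reverse.IsPath := p₀.bypass_isPath.reverse
  generalize p₀.bypass.reverse = p at hp hp'
  obtain ⟨v, hv, hvp, hfirst⟩ := p.exists_mem_support_forall_mem_support_imp_eq
    (H.verts.toFinite.toFinset) ⟨u, by simpa using hu⟩
  simp only [Set.Finite.mem_toFinset] at hv hfirst
  have hq := hp'.takeUntil hvp
  have hqe : s(u, w) ∉ (p.takeUntil v hvp).edges := fun h =>
    hp (p.edges_takeUntil_subset_edges hvp h)
  generalize p.takeUntil v hvp = q at hq hqe hfirst
  have hand := isHandle_cons huw hq hu hv huw' fun z hz hzH => hfirst z hzH hz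
  by_cases huv : u = v
  · subst huv
    exact Or.inr ⟨u, _, (Walk.cons_isCycle_iff _ _).2 ⟨hq, hqe⟩, hand⟩
  · exact Or.inl ⟨u, v, _, huv, (Walk.cons_isPath_iff _ _).2
      ⟨hq, fun h => huv (hfirst u hu h)⟩, hand⟩

lemma Walk.IsCycle.isRich_sup_path {x u v : V} {c : G.Walk x x} (hc : c.IsCycle)
    {p : G.Walk u v} (huv : u ≠ v) (hp : p.IsPath) (h : IsHandle c.toSubgraph p) :
    IsRich (c.toSubgraph ⊔ p.toSubgraph) := by
  obtain ⟨P, Q, hP, hQ, hPQ, hv, he⟩ := hc.exists_arcs (c.mem_verts_toSubgraph.1 h.left)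
    (c.mem_verts_toSubgraph.1 h.right) huv
  rw [← hPQ] at h ⊢
  have hi : ∀ z ∈ (P ⊔ Q).verts, z ∈ p.toSubgraph.verts → z = u ∨ z = v := fun z hz hz' =>
    h.inter z (p.mem_verts_toSubgraph.1 hz') hz
  exact IsTheta.isRich ⟨huv, hP, hQ, hp.isArc huv, hv, fun z hz => hi z (Or.inl hz),
    fun z hz => hi z (Or.inr hz), he, fun a b h₁ h₂ => h.edges a b h₂ (Or.inl h₁),
    fun a b h₁ h₂ => h.edges a b h₂ (Or.inr h₁)⟩

lemma Walk.IsCycle.isRich_sup_cycle {x u : V} {c : G.Walk x x} (hc : c.IsCycle)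
    {d : G.Walk u u} (hd : d.IsCycle) (h : IsHandle c.toSubgraph d) :
    IsRich (c.toSubgraph ⊔ d.toSubgraph) := by
  classical
  have hu := c.mem_verts_toSubgraph.1 h.left
  rw [← c.toSubgraph_rotate hu]
  refine isRich_of_two_cycles (hc.rotate hu) hd fun z hz hz' => ?_
  exact (h.inter z hz' (c.mem_verts_toSubgraph.2 (by simpa using hz))).elim id id

/-- A bridgeless connected graph with cyclomatic number at least three contains two internally
disjoint Steiner subgraphs for some set of four terminals. -/
theorem Connected.exists_steinerPair_of_bridgeless [Finite V] (hG : G.Connected)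
    (hbr : ∀ u v, G.Adj u v → ¬ G.IsBridge s(u, v)) (hcard : Nat.card V + 2 ≤ G.edgeSet.ncard) :
    ∃ (S : Set V) (T₁ T₂ : G.Subgraph), S.ncard = 4 ∧ SteinerPair S T₁ T₂ := by
  have hverts : ∀ H : G.Subgraph, H.verts.ncard ≤ Nat.card V := fun H => Set.ncard_le_card _
  obtain ⟨x₀⟩ := hG.nonempty
  obtain ⟨x, c, hc, hce⟩ : ∃ (x : V) (c : G.Walk x x), c.IsCycle ∧
      c.toSubgraph.edgeSet.ncard ≤ c.toSubgraph.verts.ncard := by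
    have hv₁ : (G.singletonSubgraph x₀).verts.ncard = 1 := Set.ncard_singleton x₀
    have he₁ : (G.singletonSubgraph x₀).edgeSet.ncard = 0 := by simp
    rcases hG.exists_isHandle hbr (H := G.singletonSubgraph x₀) ⟨x₀, rfl⟩ (by omega) with
      ⟨u, v, p, huv, -, h⟩ | ⟨u, c, hc, h⟩
    · exact absurd (h.left.trans h.right.symm) huv
    · refine ⟨u, c, hc, ?_⟩
      have hle : G.singletonSubgraph x₀ ≤ c.toSubgraph := by
        rw [singletonSubgraph_le_iff, ← show u = x₀ from h.left]
        exact c.start_mem_verts_toSubgraph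
      have := h.excess
      rw [sup_eq_right.2 hle] at this
      omega
  obtain ⟨H, hH, hHe⟩ : ∃ H : G.Subgraph, IsRich H ∧ H.verts.Nonempty ∧
      H.edgeSet.ncard ≤ H.verts.ncard + 1 := by
    have := hverts c.toSubgraph
    rcases hG.exists_isHandle hbr (H := c.toSubgraph) ⟨x, by simp⟩ (by omega) with
      ⟨u, v, p, huv, hp, h⟩ | ⟨u, d, hd, h⟩
    · have := h.excess
      exact ⟨_, hc.isRich_sup_path huv hp h, ⟨x, by simp⟩, by omega⟩
    · have := h.excess
      exact ⟨_, hc.isRich_sup_cycle hd h, ⟨x, by simp⟩, by omega⟩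
  have := hverts H
  rcases hG.exists_isHandle hbr (H := H) hHe.1 (by omega) with
    ⟨u, v, p, huv, hp, h⟩ | ⟨u, d, hd, h⟩
  · obtain ⟨S, hS, hHS, ⟨hu, hv⟩ | ⟨hv, hu⟩⟩ := hH.separate u h.left v h.right huv
    · obtain ⟨T₁, T₂, -, hT⟩ := hHS.attach_ear (u := u) (v := v) p.toSubgraph_connected
        (by simp) (by simp) (fun z hz => h.inter z (p.mem_verts_toSubgraph.1 hz)) h.edges h.left hv
      exact ⟨_, T₁, T₂, by rw [Set.ncard_insert_of_notMem hu, hS], hT⟩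
    · obtain ⟨T₁, T₂, -, hT⟩ := hHS.attach_ear (u := v) (v := u) p.toSubgraph_connected
        (by simp) (by simp) (fun z hz hz' => (h.inter z (p.mem_verts_toSubgraph.1 hz) hz').symm)
        h.edges h.right hu
      exact ⟨_, T₁, T₂, by rw [Set.ncard_insert_of_notMem hv, hS], hT⟩
  · obtain ⟨S, hS, hHS, hu⟩ := hH.mem u h.left
    obtain ⟨w, hw, hwu, -⟩ := hd.exists_other (v := u)
    have hinter : ∀ z ∈ d.support, z ∈ H.verts → z = u := fun z hz hz' =>
      (h.inter z hz hz').elim id id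
    obtain ⟨T₁, T₂, hT', hT⟩ := hHS.attach_cycle hd hu hinter hw hwu
    obtain ⟨U₁, U₂, rfl, hU⟩ := hHS
    refine ⟨_, T₁, T₂, ?_, hT⟩
    rw [Set.ncard_insert_of_notMem (fun hwS => hwu (hinter w hw (Or.inl ((hU.verts w).1 hwS).1))),
      hS]

lemma Subgraph.Connected.exists_spanning_tree [Finite V] {H : G.Subgraph} (hH : H.Connected) :
    ∃ T ≤ H, T.verts = H.verts ∧ T.coe.IsTree := by
  obtain ⟨F, hF, hT⟩ := hH.coe.exists_isTree_le
  let T : G.Subgraph :=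
    { verts := H.verts
      Adj := fun a b => ∃ (ha : a ∈ H.verts) (hb : b ∈ H.verts), F.Adj ⟨a, ha⟩ ⟨b, hb⟩
      adj_sub := fun ⟨_, _, h⟩ => (hF h).adj_sub
      edge_vert := fun ⟨ha, _, _⟩ => ha
      symm := ⟨fun _ _ ⟨ha, hb, h⟩ => ⟨hb, ha, h.symm⟩⟩ }
  refine ⟨T, ⟨le_rfl, fun a b ⟨_, _, h⟩ => hF h⟩, rfl, ?_⟩
  have hTF : T.coe = F := by
    ext a b
    exact ⟨fun ⟨_, _, h⟩ => h, fun h => ⟨a.2, b.2, h⟩⟩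
  rw [hTF]
  exact hT

lemma bddAbove_steinerConn [Finite V] {S : Set V} (hS : S.Nontrivial) :
    BddAbove {n : ℕ | ∃ f : Fin n → G.Subgraph, (∀ i, G.IsSteinerTree S (f i)) ∧
      ∀ i j, i ≠ j → (f i).edgeSet ∩ (f j).edgeSet = ∅ ∧ (f i).verts ∩ (f j).verts = S} := by
  refine ⟨Nat.card G.Subgraph, ?_⟩
  rintro n ⟨f, hf, hd⟩
  have hinj : Function.Injective f := by
    intro i j hij
    by_contra hne
    have hempty := (hd i j hne).1
    rw [← hij, Set.inter_self] at hempty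
    obtain ⟨a, ha, b, hb, hab⟩ := hS
    have hconn := (hf i).2.connected
    have : Nontrivial (f i).verts :=
      ⟨⟨a, (hf i).1 ha⟩, ⟨b, (hf i).1 hb⟩, fun h => hab (Subtype.ext_iff.1 h)⟩
    obtain ⟨c, hc⟩ := hconn.preconnected.exists_adj_of_nontrivial ⟨a, (hf i).1 ha⟩
    exact hempty.subset (show s(a, c.1) ∈ (f i).edgeSet from hc)
  simpa using Nat.card_le_card_of_injective f hinj

lemma bddAbove_kappaBar [Finite V] (k : ℕ) :
    BddAbove {m : ℕ | ∃ S : Finset V, S.card = k ∧ G.steinerConn ↑S = m} :=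
  ((Set.finite_range fun S : Finset V => G.steinerConn (S : Set V)).subset
    (by rintro m ⟨S, -, h⟩; exact ⟨S, h⟩)).bddAbove

lemma SteinerPair.two_le_kappaBar [Finite V] {S : Set V} {T₁ T₂ : G.Subgraph}
    (h : SteinerPair S T₁ T₂) (hS : 2 ≤ S.ncard) : 2 ≤ G.kappaBar S.ncard := by
  obtain ⟨U₁, hU₁, hv₁, ht₁⟩ := h.conn₁.exists_spanning_tree
  obtain ⟨U₂, hU₂, hv₂, ht₂⟩ := h.conn₂.exists_spanning_tree
  have hinter : T₁.verts ∩ T₂.verts = S := by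
    ext z
    exact (h.verts z).symm
  have hedges : U₁.edgeSet ∩ U₂.edgeSet = ∅ := by
    rw [Set.eq_empty_iff_forall_notMem]
    rintro ⟨a, b⟩ ⟨h₁, h₂⟩
    exact h.edges a b (hU₁.2 h₁) (hU₂.2 h₂)
  have hfin : ((S.toFinite.toFinset : Finset V) : Set V) = S := Set.Finite.coe_toFinset _
  have h₂ : 2 ≤ G.steinerConn S := by
    refine le_csSup (bddAbove_steinerConn (Set.one_lt_ncard_iff_nontrivial.1 hS))
      ⟨![U₁, U₂], ?_, ?_⟩
    · intro i
      fin_cases i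
      · exact ⟨fun z hz => hv₁ ▸ ((h.verts z).1 hz).1, ht₁⟩
      · exact ⟨fun z hz => hv₂ ▸ ((h.verts z).1 hz).2, ht₂⟩
    · intro i j hij
      fin_cases i <;> fin_cases j
      · exact absurd rfl hij
      · exact ⟨hedges, by simpa [hv₁, hv₂] using hinter⟩
      · exact ⟨by simpa [Set.inter_comm] using hedges,
          by simpa [hv₁, hv₂, Set.inter_comm] using hinter⟩
      · exact absurd rfl hij
  refine h₂.trans (le_csSup (bddAbove_kappaBar _) ⟨S.toFinite.toFinset, ?_, by rw [hfin]⟩)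
  rw [← Set.ncard_coe_finset, hfin]

lemma exists_steinerPair_of_two_le_steinerConn {S : Set V} (h : 2 ≤ G.steinerConn S) :
    ∃ T₁ T₂ : G.Subgraph, SteinerPair S T₁ T₂ := by
  have hlt : 1 < sSup {n : ℕ | ∃ f : Fin n → G.Subgraph, (∀ i, G.IsSteinerTree S (f i)) ∧
      ∀ i j, i ≠ j → (f i).edgeSet ∩ (f j).edgeSet = ∅ ∧ (f i).verts ∩ (f j).verts = S} := h
  obtain ⟨m, ⟨f, hf, hd⟩, hm⟩ := exists_lt_of_lt_csSup' hlt
  have h01 : (⟨0, by omega⟩ : Fin m) ≠ ⟨1, hm⟩ := by simp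
  refine ⟨f ⟨0, by omega⟩, f ⟨1, hm⟩, ⟨(hf _).2.connected⟩, ⟨(hf _).2.connected⟩, ?_, ?_⟩
  · intro a b h₁ h₂
    exact (hd _ _ h01).1.subset (show s(a, b) ∈ _ from ⟨h₁, h₂⟩)
  · intro z
    exact (Set.ext_iff.1 (hd _ _ h01).2 z).symm

lemma Connected.kappaBar_eq_one [Finite V] (hG : G.Connected) {k : ℕ} (hk : 2 ≤ k)
    (hkV : k ≤ Nat.card V)
    (hno : ∀ (S : Set V) (T₁ T₂ : G.Subgraph), S.ncard = k → ¬ SteinerPair S T₁ T₂) :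
    G.kappaBar k = 1 := by
  have hle : ∀ S : Finset V, S.card = k → G.steinerConn (S : Set V) ≤ 1 := by
    intro S hS
    by_contra! hlt
    obtain ⟨T₁, T₂, hT⟩ := exists_steinerPair_of_two_le_steinerConn hlt
    exact hno S T₁ T₂ (by simpa using hS) hT
  cases nonempty_fintype V
  obtain ⟨S, -, hS⟩ := Finset.exists_subset_card_eq (s := (Finset.univ : Finset V)) (n := k)
    (by simpa using hkV)
  obtain ⟨T, -, hT, htree⟩ := (hG.toSubgraph le_rfl).exists_spanning_tree
  refine le_antisymm (csSup_le ⟨_, S, hS, rfl⟩ ?_) ?_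
  · rintro m ⟨S, hS, rfl⟩
    exact hle S hS
  · have h₁ : 1 ≤ G.steinerConn (S : Set V) := by
      refine le_csSup (bddAbove_steinerConn ?_) ⟨fun _ => T, fun _ => ⟨?_, htree⟩, ?_⟩
      · exact Set.one_lt_ncard_iff_nontrivial.1 (by simpa [hS] using Nat.lt_of_succ_le hk)
      · simp [hT]
      · intro i j hij
        exact absurd (Subsingleton.elim i j) hij
    exact h₁.trans (le_csSup (bddAbove_kappaBar k) ⟨S, hS, rfl⟩)

lemma Subgraph.Connected.map_hom {W : Type*} {G' : SimpleGraph W} {H : G.Subgraph}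
    (hH : H.Connected) (f : G →g G') : (H.map f).Connected := by
  rw [Subgraph.connected_iff]
  refine ⟨?_, hH.nonempty.image f⟩
  rw [Subgraph.preconnected_iff_forall_exists_walk_subgraph]
  rintro _ _ ⟨a, ha, rfl⟩ ⟨b, hb, rfl⟩
  obtain ⟨p, hp⟩ :=
    (Subgraph.preconnected_iff_forall_exists_walk_subgraph H).1 hH.preconnected ha hb
  exact ⟨p.map f, by rw [Walk.toSubgraph_map]; exact Subgraph.map_mono hp⟩

lemma SteinerPair.map {W : Type*} {G' : SimpleGraph W} {S : Set V} {T₁ T₂ : G.Subgraph}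
    (h : SteinerPair S T₁ T₂) (f : G ↪g G') :
    SteinerPair (f '' S) (T₁.map f.toHom) (T₂.map f.toHom) where
  conn₁ := h.conn₁.map_hom _
  conn₂ := h.conn₂.map_hom _
  edges := by
    rintro _ _ ⟨a, b, hab, rfl, rfl⟩ ⟨a', b', hab', ha, hb⟩
    obtain rfl := f.injective ha
    obtain rfl := f.injective hb
    exact h.edges _ _ hab hab'
  verts := by
    intro z
    constructor
    · rintro ⟨a, ha, rfl⟩
      exact ⟨⟨a, ((h.verts a).1 ha).1, rfl⟩, ⟨a, ((h.verts a).1 ha).2, rfl⟩⟩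
    · rintro ⟨⟨a, ha, rfl⟩, ⟨b, hb, hba⟩⟩
      obtain rfl := f.injective hba
      exact ⟨b, (h.verts b).2 ⟨ha, hb⟩, rfl⟩

/-- A bridge splits the vertices into two connected parts between which it is the only edge. -/
lemma IsBridge.exists_connected_parts (hG : G.Connected) {u v : V} (h : G.IsBridge s(u, v)) :
    ∃ A B : Set V, u ∈ A ∧ v ∈ B ∧ Disjoint A B ∧ A ∪ B = Set.univ ∧
      (G.induce A).Connected ∧ (G.induce B).Connected ∧
      ∀ a b, G.Adj a b → s(a, b) = s(u, v) ∨ (a ∈ A ∧ b ∈ A) ∨ (a ∈ B ∧ b ∈ B) := by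
  set G' := G.deleteEdges {s(u, v)} with hG'
  have hadj : ∀ a b, G.Adj a b → s(a, b) = s(u, v) ∨ G'.Adj a b := by
    intro a b hab
    by_cases he : s(a, b) = s(u, v)
    · exact Or.inl he
    · exact Or.inr (deleteEdges_adj.2 ⟨hab, he⟩)
  have hconn : ∀ C : G'.ConnectedComponent, (G.induce C.supp).Connected := fun C =>
    C.connected_toSimpleGraph.mono (comap_monotone _ (deleteEdges_le _))
  have hmem : ∀ C : G'.ConnectedComponent, ∀ a b, G'.Adj a b → a ∈ C.supp → b ∈ C.supp :=
    fun C a b hab ha => C.mem_supp_of_adj_mem_supp ha hab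
  have hcover : ∀ z, z ∈ (G'.connectedComponentMk u).supp ∪ (G'.connectedComponentMk v).supp := by
    intro z
    obtain ⟨p⟩ := hG.preconnected z u
    clear_value G'
    induction p with
    | nil => exact Or.inl rfl
    | @cons a b c hab p ih =>
      rcases hadj a b hab with he | hab'
      · rcases Sym2.eq_iff.1 he with ⟨rfl, -⟩ | ⟨rfl, -⟩
        · exact Or.inl rfl
        · exact Or.inr rfl
      · rcases ih h hG' hadj with hb | hb
        · exact Or.inl (hmem _ _ _ hab'.symm hb)
        · exact Or.inr (hmem _ _ _ hab'.symm hb)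
  refine ⟨(G'.connectedComponentMk u).supp, (G'.connectedComponentMk v).supp, rfl, rfl, ?_,
    Set.eq_univ_of_forall hcover, hconn _, hconn _, ?_⟩
  · rw [Set.disjoint_left]
    intro z hu hv
    rw [ConnectedComponent.mem_supp_iff] at hu hv
    exact isBridge_iff.1 h (ConnectedComponent.exact (hu.symm.trans hv))
  · intro a b hab
    refine (hadj a b hab).imp_right fun hab' => (hcover a).imp (fun ha => ?_) fun ha => ?_
    · exact ⟨ha, hmem _ _ _ hab' ha⟩
    · exact ⟨ha, hmem _ _ _ hab' ha⟩

/-- The edge bound for connected graphs without two internally disjoint Steiner trees on four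
terminals. -/
theorem Connected.ncard_edgeSet_lt [Finite V] (hG : G.Connected)
    (hno : ∀ (S : Set V) (T₁ T₂ : G.Subgraph), S.ncard = 4 → ¬ SteinerPair S T₁ T₂) :
    G.edgeSet.ncard < Nat.card V + (2 * (Nat.card V / 4) + Nat.card V % 4 / 3) := by
  induction hn : Nat.card V using Nat.strong_induction_on generalizing V with
  | _ n ih =>
  by_cases hbr : ∃ u v, G.Adj u v ∧ G.IsBridge s(u, v)
  · obtain ⟨u, v, huv, hb⟩ := hbr
    obtain ⟨A, B, huA, hvB, hdisj, hunion, hA, hB, hadj⟩ := hb.exists_connected_parts hG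
    have hcard : A.ncard + B.ncard = n := by
      rw [← Set.ncard_union_eq hdisj, hunion, Set.ncard_univ, hn]
    have hA0 : 0 < A.ncard := (Set.ncard_pos A.toFinite).2 ⟨u, huA⟩
    have hB0 : 0 < B.ncard := (Set.ncard_pos B.toFinite).2 ⟨v, hvB⟩
    have transfer : ∀ X : Set V, ∀ (S : Set X) (T₁ T₂ : (G.induce X).Subgraph), S.ncard = 4 →
        ¬ SteinerPair S T₁ T₂ := by
      intro X S T₁ T₂ hS hT
      refine hno _ _ _ ?_ (hT.map (Embedding.induce X))
      rw [Set.ncard_image_of_injective _ (Embedding.induce X).injective, hS]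
    have ihA := ih _ (by omega) hA (transfer A) (Nat.card_coe_set_eq A)
    have ihB := ih _ (by omega) hB (transfer B) (Nat.card_coe_set_eq B)
    have hsub : G.edgeSet ⊆ insert s(u, v)
        (Sym2.map Subtype.val '' (G.induce A).edgeSet ∪
          Sym2.map Subtype.val '' (G.induce B).edgeSet) := by
      rintro ⟨a, b⟩ hab
      rcases hadj a b hab with he | ⟨ha, hb⟩ | ⟨ha, hb⟩
      · exact Or.inl he
      · exact Or.inr (Or.inl ⟨s(⟨a, ha⟩, ⟨b, hb⟩), hab, rfl⟩)
      · exact Or.inr (Or.inr ⟨s(⟨a, ha⟩, ⟨b, hb⟩), hab, rfl⟩)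
    have h₁ := Set.ncard_le_ncard hsub (Set.toFinite _)
    have h₂ := Set.ncard_insert_le s(u, v) (Sym2.map Subtype.val '' (G.induce A).edgeSet ∪
          Sym2.map Subtype.val '' (G.induce B).edgeSet)
    have h₃ := Set.ncard_union_le (Sym2.map Subtype.val '' (G.induce A).edgeSet)
          (Sym2.map Subtype.val '' (G.induce B).edgeSet)
    have h₄ := Set.ncard_image_le (f := Sym2.map Subtype.val) (G.induce A).edgeSet.toFinite
    have h₅ := Set.ncard_image_le (f := Sym2.map Subtype.val) (G.induce B).edgeSet.toFinite
    omega
  · push Not at hbr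
    by_cases h4 : 4 ≤ n
    · by_contra! hge
      obtain ⟨S, T₁, T₂, hS, hT⟩ := hG.exists_steinerPair_of_bridgeless hbr (by omega)
      exact hno S T₁ T₂ hS hT
    · classical
      cases nonempty_fintype V
      have hle := G.card_edgeFinset_le_card_choose_two
      rw [← Set.ncard_coe_finset, coe_edgeFinset, ← Nat.card_eq_fintype_card, hn] at hle
      have hpos : 0 < n := by
        have := hG.nonempty
        rw [← hn]
        exact Nat.card_pos
      refine hle.trans_lt ?_
      interval_cases n <;> decide

lemma Subgraph.Connected.exists_adj_boundary {T : G.Subgraph} (hT : T.Connected) {X : Set V}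
    {a b : V} (ha : a ∈ T.verts) (hb : b ∈ T.verts) (haX : a ∈ X) (hbX : b ∉ X) :
    ∃ x ∈ X, ∃ y ∉ X, T.Adj x y := by
  obtain ⟨p⟩ := hT.coe.preconnected ⟨a, ha⟩ ⟨b, hb⟩
  obtain ⟨d, -, hd₁, hd₂⟩ := p.exists_boundary_dart (Subtype.val ⁻¹' X) haX hbX
  exact ⟨d.fst, hd₁, d.snd, hd₂, d.adj⟩

/-- Consecutive blocks of four vertices, each inducing `K₄` minus an edge; the first vertex of each
block is joined to the first vertex of the first block. -/
def blockGraph (n : ℕ) : SimpleGraph (Fin n) where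
  Adj a b := a ≠ b ∧ ((a.val / 4 = b.val / 4 ∧ ¬ (a.val % 4 = 2 ∧ b.val % 4 = 3) ∧
      ¬ (a.val % 4 = 3 ∧ b.val % 4 = 2)) ∨ (a.val = 0 ∧ b.val % 4 = 0) ∨
      (b.val = 0 ∧ a.val % 4 = 0))
  symm := ⟨fun a b h => by grind⟩
  loopless := ⟨fun a h => h.1 rfl⟩

namespace blockGraph

variable {n : ℕ}

lemma connected (hn : 0 < n) : (blockGraph n).Connected := by
  have hreach : ∀ b : Fin n, (blockGraph n).Reachable b ⟨0, hn⟩ := by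
    intro b
    have h₁ : (blockGraph n).Reachable b ⟨4 * (b.val / 4), by omega⟩ := by
      by_cases h : b.val % 4 = 0
      · have hb : (⟨4 * (b.val / 4), by omega⟩ : Fin n) = b := Fin.ext (by simp only; omega)
        rw [hb]
      · refine Adj.reachable ⟨fun he => ?_, Or.inl ?_⟩
        · have := congrArg Fin.val he
          simp only at this
          omega
        · simp only
          omega
    refine h₁.trans ?_
    by_cases h : b.val / 4 = 0
    · simp only [h]
      exact Reachable.refl _
    · refine Adj.reachable ⟨fun he => ?_, Or.inr (Or.inr ?_)⟩
      · have := congrArg Fin.val he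
        simp only at this
        omega
      · exact ⟨rfl, by simp only; omega⟩
  have : Nonempty (Fin n) := ⟨⟨0, hn⟩⟩
  exact ⟨fun a b => (hreach a).trans (hreach b).symm⟩

lemma card_filter_two_le_mod (n : ℕ) :
    ({b : Fin n | 2 ≤ b.val % 4} : Finset (Fin n)).card = 2 * (n / 4) + n % 4 / 3 := by
  rw [Finset.card_filter, Fin.sum_univ_eq_sum_range (fun i => if 2 ≤ i % 4 then 1 else 0)]
  induction n with
  | zero => simp
  | succ n ih =>
    rw [Finset.sum_range_succ, ih]
    split_ifs <;> omega

lemma le_ncard_edgeSet (hn : 0 < n) :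
    n + (2 * (n / 4) + n % 4 / 3) ≤ (blockGraph n).edgeSet.ncard + 1 := by
  let c (b : Fin n) : Fin n := ⟨b - if b.val % 4 = 0 then b.val else b.val % 4, by omega⟩
  let d (b : Fin n) : Fin n := ⟨b - (b.val % 4 - 1), by omega⟩
  have key : ∀ {a b a' b' : Fin n}, a < b → a' < b' → s(b, a) = s(b', a') → b = b' ∧ a = a' := by
    intro a b a' b' h h' he
    rcases Sym2.eq_iff.1 he with he | ⟨rfl, rfl⟩
    · exact he
    · exact absurd h' h.not_gt
  let F : Finset (Sym2 (Fin n)) := (Finset.univ.erase ⟨0, hn⟩).image fun b => s(b, c b)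
  let K : Finset (Sym2 (Fin n)) := ({b : Fin n | 2 ≤ b.val % 4} : Finset (Fin n)).image
    fun b => s(b, d b)
  have hc : ∀ b ∈ Finset.univ.erase (⟨0, hn⟩ : Fin n), c b < b := by
    intro b hb
    have : b.val ≠ 0 := fun h => Finset.ne_of_mem_erase hb (Fin.ext h)
    simp only [c, Fin.lt_def]
    split_ifs <;> omega
  have hd : ∀ b ∈ ({b : Fin n | 2 ≤ b.val % 4} : Finset (Fin n)), d b < b := by
    intro b hb
    have := (Finset.mem_filter.1 hb).2
    simp only [d, Fin.lt_def]
    omega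
  have hF : F.card + 1 = n := by
    rw [Finset.card_image_of_injOn, Finset.card_erase_of_mem (Finset.mem_univ _),
      Finset.card_univ, Fintype.card_fin]
    · omega
    · exact fun b hb b' hb' he => (key (hc b hb) (hc b' hb') he).1
  have hK : K.card = 2 * (n / 4) + n % 4 / 3 := by
    rw [Finset.card_image_of_injOn, card_filter_two_le_mod]
    exact fun b hb b' hb' he => (key (hd b hb) (hd b' hb') he).1
  have hdisj : Disjoint F K := by
    rw [Finset.disjoint_left]
    intro e heF heK
    obtain ⟨b, hb, rfl⟩ := Finset.mem_image.1 heF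
    obtain ⟨b', hb', he⟩ := Finset.mem_image.1 heK
    obtain ⟨rfl, h⟩ := key (hd b' hb') (hc b hb) he
    have hb2 := (Finset.mem_filter.1 hb').2
    have := congrArg Fin.val h
    simp only [c, d] at this
    split_ifs at this <;> omega
  have hsub : ((F ∪ K : Finset (Sym2 (Fin n))) : Set (Sym2 (Fin n))) ⊆ (blockGraph n).edgeSet := by
    intro e he
    rcases Finset.mem_union.1 he with he | he
    · obtain ⟨b, hb, rfl⟩ := Finset.mem_image.1 he
      refine ⟨(hc b hb).ne', ?_⟩
      simp only [c]
      split_ifs <;> omega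
    · obtain ⟨b, hb, rfl⟩ := Finset.mem_image.1 he
      have hb2 := (Finset.mem_filter.1 hb).2
      refine ⟨(hd b hb).ne', ?_⟩
      simp only [d]
      omega
  have hle := Set.ncard_le_ncard hsub (Set.toFinite _)
  rw [Set.ncard_coe_finset, Finset.card_union_of_disjoint hdisj, hK] at hle
  omega

/-- Cutting a tree along a part of a block that avoids its first vertex only meets edges of the
block. -/
lemma exists_adj_block {T : (blockGraph n).Subgraph} (hT : T.Connected) {k : ℕ}
    {w : Fin 4 → Fin n} (hw : ∀ i, (w i).val = 4 * k + i) (hwT : ∀ i, w i ∈ T.verts)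
    (P : Finset (Fin 4)) (h0 : 0 ∉ P) (hP : P.Nonempty) :
    ∃ i ∈ P, ∃ j ∉ P, T.Adj (w i) (w j) := by
  have hinj : Function.Injective w := by
    intro i j hij
    have := hw i
    rw [hij, hw j] at this
    exact Fin.ext (by omega)
  obtain ⟨i₀, hi₀⟩ := hP
  obtain ⟨_, ⟨i, hi, rfl⟩, y, hy, hadj⟩ := hT.exists_adj_boundary (X := w '' P) (hwT i₀) (hwT 0)
    ⟨i₀, hi₀, rfl⟩ (by rintro ⟨j, hj, hj0⟩; exact h0 (hinj hj0 ▸ hj))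
  have hi0 : i.val ≠ 0 := fun h => h0 ((Fin.ext h : i = 0) ▸ hi)
  obtain ⟨-, hG⟩ := T.adj_sub hadj
  have hwi := hw i
  have hyw : y = w ⟨y.val % 4, by omega⟩ := by
    refine Fin.ext ?_
    rw [hw]
    simp only
    omega
  refine ⟨i, hi, ⟨y.val % 4, by omega⟩, fun hj => hy ⟨_, hj, hyw.symm⟩, hyw ▸ hadj⟩

lemma div_eq_of_steinerPair {S : Set (Fin n)} {T₁ T₂ : (blockGraph n).Subgraph}
    (h : SteinerPair S T₁ T₂) {a b : Fin n} (ha : a ∈ S) (hb : b ∈ S) :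
    a.val / 4 = b.val / 4 := by
  by_contra hab
  wlog ha0 : a.val / 4 ≠ 0 generalizing a b
  · exact this hb ha (Ne.symm hab) (by omega)
  have hedge : ∀ T : (blockGraph n).Subgraph, T.Connected → a ∈ T.verts → b ∈ T.verts →
      T.Adj ⟨4 * (a.val / 4), by omega⟩ ⟨0, by omega⟩ := by
    intro T hT haT hbT
    obtain ⟨x, hx, y, hy, hxy⟩ := hT.exists_adj_boundary (X := {z | z.val / 4 = a.val / 4}) haT hbT
      rfl (Ne.symm hab)
    obtain ⟨-, hG⟩ := T.adj_sub hxy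
    simp only [Set.mem_ofPred_eq] at hx hy
    rw [show (⟨4 * (a.val / 4), by omega⟩ : Fin n) = x from Fin.ext (by simp only; omega),
      show (⟨0, by omega⟩ : Fin n) = y from Fin.ext (by simp only; omega)]
    exact hxy
  have ha' := (h.verts a).1 ha
  have hb' := (h.verts b).1 hb
  exact h.edges _ _ (hedge T₁ h.conn₁ ha'.1 hb'.1) (hedge T₂ h.conn₂ ha'.2 hb'.2)

lemma not_steinerPair (S : Set (Fin n)) (T₁ T₂ : (blockGraph n).Subgraph) (hS : S.ncard = 4) :
    ¬ SteinerPair S T₁ T₂ := by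
  intro h
  obtain ⟨a, ha⟩ := Set.nonempty_of_ncard_ne_zero (s := S) (by omega)
  have hinj : Set.InjOn (fun z : Fin n => z.val % 4) S := by
    intro x hx y hy hxy
    have := div_eq_of_steinerPair h hx hy
    simp only at hxy
    exact Fin.ext (by omega)
  have himage : (fun z : Fin n => z.val % 4) '' S = Finset.range 4 := by
    refine Set.eq_of_subset_of_ncard_le ?_ ?_ (Set.toFinite _)
    · rintro _ ⟨z, -, rfl⟩
      simp only [Finset.coe_range, Set.mem_Iio]
      omega
    · rw [hinj.ncard_image, hS, Set.ncard_coe_finset, Finset.card_range]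
  have hex : ∀ i : Fin 4, ∃ w ∈ S, w.val = 4 * (a.val / 4) + i := by
    intro i
    have hi : i.val ∈ (fun z : Fin n => z.val % 4) '' S := by
      rw [himage]
      simp
    obtain ⟨w, hw, hwi⟩ := hi
    refine ⟨w, hw, ?_⟩
    have := div_eq_of_steinerPair h hw ha
    simp only at hwi
    omega
  choose w hwS hw using hex
  have h23 : ∀ T : (blockGraph n).Subgraph, ¬ T.Adj (w 2) (w 3) := by
    intro T hT
    obtain ⟨-, hG⟩ := T.adj_sub hT
    have h2 := hw 2
    have h3 := hw 3
    simp only [Fin.isValue, Fin.val_two, show ((3 : Fin 4) : ℕ) = 3 from rfl] at h2 h3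
    omega
  have cuts : ∀ T : (blockGraph n).Subgraph, T.Connected → (∀ i, w i ∈ T.verts) →
      (T.Adj (w 0) (w 2) ∨ T.Adj (w 1) (w 2)) ∧ (T.Adj (w 0) (w 3) ∨ T.Adj (w 1) (w 3)) ∧
      (T.Adj (w 0) (w 1) ∨ T.Adj (w 1) (w 2) ∨ T.Adj (w 1) (w 3)) ∧
      (T.Adj (w 0) (w 1) ∨ T.Adj (w 0) (w 2) ∨ T.Adj (w 1) (w 3)) ∧
      (T.Adj (w 0) (w 1) ∨ T.Adj (w 0) (w 3) ∨ T.Adj (w 1) (w 2)) ∧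
      (T.Adj (w 0) (w 1) ∨ T.Adj (w 0) (w 2) ∨ T.Adj (w 0) (w 3)) := by
    intro T hT hwT
    have c := exists_adj_block hT hw hwT
    have h₁ := c {2} (by decide) (by decide)
    have h₂ := c {3} (by decide) (by decide)
    have h₃ := c {1} (by decide) (by decide)
    have h₄ := c {1, 2} (by decide) (by decide)
    have h₅ := c {1, 3} (by decide) (by decide)
    have h₆ := c {1, 2, 3} (by decide) (by decide)
    have s := fun i j => T.adj_comm (w i) (w j)
    have h := h23 T
    simp [Fin.exists_fin_succ, s 1 0, s 2 0, s 2 1, s 3 0, s 3 1, s 3 2, h] at h₁ h₂ h₃ h₄ h₅ h₆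
    clear * - h₁ h₂ h₃ h₄ h₅ h₆
    grind
  have h₁ := cuts T₁ h.conn₁ fun i => ((h.verts _).1 (hwS i)).1
  have h₂ := cuts T₂ h.conn₂ fun i => ((h.verts _).1 (hwS i)).2
  have e := fun i j => h.edges (w i) (w j)
  have e₀₁ := e 0 1
  have e₀₂ := e 0 2
  have e₀₃ := e 0 3
  have e₁₂ := e 1 2
  have e₁₃ := e 1 3
  clear * - h₁ h₂ e₀₁ e₀₂ e₀₃ e₁₂ e₁₃
  grind

end blockGraph

end SimpleGraph

/-- For `n = 4r + q`, `r ≥ 1`, `0 ≤ q ≤ 3`, the maximum number of edges of a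
connected graph on `n` vertices with `κ̄₄ = 1` equals `(3n-2)/2`, `(3n-3)/2`, `(3n-4)/2`,
`(3n-3)/2` according as `q = 0, 1, 2, 3`, and it is attained. -/
theorem stmt_13 (r q n : ℕ) (hr : 1 ≤ r) (hq : q ≤ 3) (hn : n = 4 * r + q) :
    IsGreatest {m : ℕ | ∃ G : SimpleGraph (Fin n),
        G.Connected ∧ G.kappaBar 4 = 1 ∧ G.edgeSet.ncard = m}
      (if q = 0 then (3 * n - 2) / 2
       else if q = 2 then (3 * n - 4) / 2
       else (3 * n - 3) / 2) := by
  have hvalue : (if q = 0 then (3 * n - 2) / 2 else if q = 2 then (3 * n - 4) / 2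
      else (3 * n - 3) / 2) + 1 = n + (2 * (n / 4) + n % 4 / 3) := by
    split_ifs <;> omega
  have hbound : ∀ G : SimpleGraph (Fin n), G.Connected →
      (∀ (S : Set (Fin n)) (T₁ T₂ : G.Subgraph), S.ncard = 4 → ¬ SteinerPair S T₁ T₂) →
      G.edgeSet.ncard < n + (2 * (n / 4) + n % 4 / 3) := by
    intro G hG hno
    simpa using hG.ncard_edgeSet_lt hno
  constructor
  · have hconn := blockGraph.connected (n := n) (by omega)
    refine ⟨blockGraph n, hconn, hconn.kappaBar_eq_one (by norm_num) ?_
      blockGraph.not_steinerPair, ?_⟩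
    · rw [Nat.card_eq_fintype_card, Fintype.card_fin]
      omega
    · have h₁ := blockGraph.le_ncard_edgeSet (n := n) (by omega)
      have h₂ := hbound _ hconn blockGraph.not_steinerPair
      omega
  · rintro _ ⟨G, hG, hk, rfl⟩
    have := hbound G hG fun S T₁ T₂ hS hT => by
      have h₂ := hT.two_le_kappaBar (by omega)
      rw [hS, hk] at h₂
      omega
    omega
end

section
/- Let G be a connected graph on n ≥ 5 vertices with κ̄_n(G) = 1 (equivalently, G does not contain two edge-disjoint spanning trees). Then e(G) ≤ C(n−1, 2) + 1. -/
open SimpleGraph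

namespace SimpleGraph

variable {V : Type*}

/-- `G` contains two edge-disjoint connected spanning subgraphs. -/
def HasTwoDisjointConnected (G : SimpleGraph V) : Prop :=
  ∃ H₁ H₂ : SimpleGraph V, H₁ ≤ G ∧ H₂ ≤ G ∧ Disjoint H₁ H₂ ∧ H₁.Connected ∧ H₂.Connected

theorem connected_of_forall_reachable (H : SimpleGraph V) (r : V) (h : ∀ x, H.Reachable x r) :
    H.Connected :=
  have : Nonempty V := ⟨r⟩
  ⟨fun x y ↦ (h x).trans (h y).symm⟩

theorem connected_map_sup_edge {v a : V} (hav : a ≠ v) {H : SimpleGraph {x // x ≠ v}}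
    (hH : H.Connected) :
    (H.map (Function.Embedding.subtype _) ⊔ edge v a).Connected := by
  refine connected_of_forall_reachable _ a fun x ↦ ?_
  by_cases hx : x = v
  · subst hx
    exact Adj.reachable (by simp [edge_adj, hav, hav.symm])
  · have h := (hH.preconnected ⟨x, hx⟩ ⟨a, hav⟩).map
      (Embedding.map (Function.Embedding.subtype _) H).toHom
    exact Reachable.mono le_sup_left h

/-- A vertex with two distinct neighbours can be added back to a graph with two edge-disjoint
connected spanning subgraphs. -/
theorem HasTwoDisjointConnected.of_comap {G : SimpleGraph V} {v a b : V} (hab : a ≠ b)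
    (ha : G.Adj v a) (hb : G.Adj v b)
    (h : (G.comap (Subtype.val : {x // x ≠ v} → V)).HasTwoDisjointConnected) :
    G.HasTwoDisjointConnected := by
  obtain ⟨H₁, H₂, h₁, h₂, hd, hc₁, hc₂⟩ := h
  have hle : ∀ (H : SimpleGraph {x // x ≠ v}) (c : V),
      H ≤ G.comap (Subtype.val : {x // x ≠ v} → V) → G.Adj v c →
      H.map (Function.Embedding.subtype _) ⊔ edge v c ≤ G := by
    intro H c hH hc
    refine sup_le ?_ ?_
    · rintro _ _ ⟨-, x, y, hxy, rfl, rfl⟩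
      exact hH hxy
    · intro x y hxy
      rw [edge_adj] at hxy
      rcases hxy.1 with ⟨rfl, rfl⟩ | ⟨rfl, rfl⟩
      exacts [hc, hc.symm]
  refine ⟨_, _, hle H₁ a h₁ ha, hle H₂ b h₂ hb, ?_,
    connected_map_sup_edge ha.ne' hc₁, connected_map_sup_edge hb.ne' hc₂⟩
  rw [disjoint_left] at hd ⊢
  intro x y hx hy
  simp only [sup_adj, map_adj, edge_adj, Function.Embedding.subtype_apply] at hx hy
  rcases hx with ⟨x₁, y₁, hxy, rfl, rfl⟩ | hx
  · rcases hy with ⟨x₂, y₂, hxy', hx, hy⟩ | hy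
    · rw [Subtype.val_inj] at hx hy
      subst hx hy
      exact hd _ _ hxy hxy'
    · have := x₁.2
      have := y₁.2
      grind
  · rcases hy with ⟨x₂, y₂, -, rfl, rfl⟩ | hy
    · have := x₂.2
      have := y₂.2
      grind
    · grind

/-- The complete graph on five vertices minus two disjoint edges `ab` and `cd`. -/
theorem hasTwoDisjointConnected_of_matching {G : SimpleGraph V} {a b c d e : V}
    (hl : [a, b, c, d, e].Nodup) (hV : ∀ x, x ∈ [a, b, c, d, e])
    (hG : ∀ x y, x ≠ y → ¬ G.Adj x y → s(x, y) = s(a, b) ∨ s(x, y) = s(c, d)) :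
    G.HasTwoDisjointConnected := by
  have hcon : ∀ x y, x ≠ y → s(x, y) ≠ s(a, b) → s(x, y) ≠ s(c, d) → G.Adj x y := by
    grind
  simp only [ne_eq, Sym2.eq_iff] at hcon
  simp only [List.nodup_cons, List.mem_cons, List.not_mem_nil, or_false, not_or] at hl hV
  refine ⟨fromEdgeSet {s(a, e), s(c, a), s(b, e), s(d, b)},
    fromEdgeSet {s(c, e), s(b, c), s(d, e), s(a, d)}, ?_, ?_, ?_, ?_, ?_⟩
  · intro x y hxy
    simp only [fromEdgeSet_adj, Set.mem_insert_iff, Set.mem_singleton_iff, Sym2.eq_iff] at hxy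
    grind
  · intro x y hxy
    simp only [fromEdgeSet_adj, Set.mem_insert_iff, Set.mem_singleton_iff, Sym2.eq_iff] at hxy
    grind
  · rw [disjoint_left]
    intro x y hxy hxy'
    simp only [fromEdgeSet_adj, Set.mem_insert_iff, Set.mem_singleton_iff, Sym2.eq_iff] at hxy hxy'
    grind
  · set H := fromEdgeSet {s(a, e), s(c, a), s(b, e), s(d, b)} with hH
    have ha : H.Reachable a e := Adj.reachable (by simp [hH]; grind)
    have hc : H.Reachable c e := (Adj.reachable (v := a) (by simp [hH]; grind)).trans ha
    have hb : H.Reachable b e := Adj.reachable (by simp [hH]; grind)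
    have hd : H.Reachable d e := (Adj.reachable (v := b) (by simp [hH]; grind)).trans hb
    refine connected_of_forall_reachable H e fun x ↦ ?_
    rcases hV x with rfl | rfl | rfl | rfl | rfl
    exacts [ha, hb, hc, hd, .rfl]
  · set H := fromEdgeSet {s(c, e), s(b, c), s(d, e), s(a, d)} with hH
    have hc : H.Reachable c e := Adj.reachable (by simp [hH]; grind)
    have hb : H.Reachable b e := (Adj.reachable (v := c) (by simp [hH]; grind)).trans hc
    have hd : H.Reachable d e := Adj.reachable (by simp [hH]; grind)
    have ha : H.Reachable a e := (Adj.reachable (v := d) (by simp [hH]; grind)).trans hd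
    refine connected_of_forall_reachable H e fun x ↦ ?_
    rcases hV x with rfl | rfl | rfl | rfl | rfl
    exacts [ha, hb, hc, hd, .rfl]

/-- The complete graph on five vertices minus two edges `ab` and `ac` sharing a vertex. -/
theorem hasTwoDisjointConnected_of_path {G : SimpleGraph V} {a b c d e : V}
    (hl : [a, b, c, d, e].Nodup) (hV : ∀ x, x ∈ [a, b, c, d, e])
    (hG : ∀ x y, x ≠ y → ¬ G.Adj x y → s(x, y) = s(a, b) ∨ s(x, y) = s(a, c)) :
    G.HasTwoDisjointConnected := by
  have hcon : ∀ x y, x ≠ y → s(x, y) ≠ s(a, b) → s(x, y) ≠ s(a, c) → G.Adj x y := by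
    grind
  simp only [ne_eq, Sym2.eq_iff] at hcon
  simp only [List.nodup_cons, List.mem_cons, List.not_mem_nil, or_false, not_or] at hl hV
  refine ⟨fromEdgeSet {s(d, e), s(c, d), s(b, c), s(a, d)},
    fromEdgeSet {s(b, e), s(c, e), s(d, b), s(a, e)}, ?_, ?_, ?_, ?_, ?_⟩
  · intro x y hxy
    simp only [fromEdgeSet_adj, Set.mem_insert_iff, Set.mem_singleton_iff, Sym2.eq_iff] at hxy
    grind
  · intro x y hxy
    simp only [fromEdgeSet_adj, Set.mem_insert_iff, Set.mem_singleton_iff, Sym2.eq_iff] at hxy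
    grind
  · rw [disjoint_left]
    intro x y hxy hxy'
    simp only [fromEdgeSet_adj, Set.mem_insert_iff, Set.mem_singleton_iff, Sym2.eq_iff] at hxy hxy'
    grind
  · set H := fromEdgeSet {s(d, e), s(c, d), s(b, c), s(a, d)} with hH
    have hd : H.Reachable d e := Adj.reachable (by simp [hH]; grind)
    have hc : H.Reachable c e := (Adj.reachable (v := d) (by simp [hH]; grind)).trans hd
    have hb : H.Reachable b e := (Adj.reachable (v := c) (by simp [hH]; grind)).trans hc
    have ha : H.Reachable a e := (Adj.reachable (v := d) (by simp [hH]; grind)).trans hd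
    refine connected_of_forall_reachable H e fun x ↦ ?_
    rcases hV x with rfl | rfl | rfl | rfl | rfl
    exacts [ha, hb, hc, hd, .rfl]
  · set H := fromEdgeSet {s(b, e), s(c, e), s(d, b), s(a, e)} with hH
    have hb : H.Reachable b e := Adj.reachable (by simp [hH]; grind)
    have hc : H.Reachable c e := Adj.reachable (by simp [hH]; grind)
    have hd : H.Reachable d e := (Adj.reachable (v := b) (by simp [hH]; grind)).trans hb
    have ha : H.Reachable a e := Adj.reachable (by simp [hH]; grind)
    refine connected_of_forall_reachable H e fun x ↦ ?_
    rcases hV x with rfl | rfl | rfl | rfl | rfl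
    exacts [ha, hb, hc, hd, .rfl]

theorem exists_notMem_of_length_lt_card [Fintype V] {l : List V}
    (h : l.length < Fintype.card V) : ∃ x, x ∉ l := by
  classical
  by_contra! hl
  have : Finset.univ ⊆ l.toFinset := fun x _ ↦ by simpa using hl x
  have := Finset.card_le_card this
  have := l.toFinset_card_le
  rw [Finset.card_univ] at *
  omega

theorem mem_of_nodup_of_length_eq_card [Fintype V] {l : List V} (hl : l.Nodup)
    (h : l.length = Fintype.card V) (x : V) : x ∈ l := by
  classical
  have : l.toFinset = Finset.univ := by
    rw [← Finset.card_eq_iff_eq_univ, List.toFinset_card_of_nodup hl, h]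
  simpa [← this] using Finset.mem_univ x

theorem hasTwoDisjointConnected_of_card_eq_five [Fintype V] {G : SimpleGraph V}
    (hV : Fintype.card V = 5) (hG : Gᶜ.edgeSet.ncard ≤ 2) : G.HasTwoDisjointConnected := by
  classical
  have hpath : ∀ a b c : V, a ≠ b → a ≠ c → b ≠ c →
      (∀ x y, x ≠ y → ¬ G.Adj x y → s(x, y) = s(a, b) ∨ s(x, y) = s(a, c)) →
      G.HasTwoDisjointConnected := by
    intro a b c hab hac hbc h
    obtain ⟨d, hd⟩ := exists_notMem_of_length_lt_card (l := [a, b, c]) (by simp [hV])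
    obtain ⟨e, he⟩ := exists_notMem_of_length_lt_card (l := [a, b, c, d]) (by simp [hV])
    have hl : [a, b, c, d, e].Nodup := by grind
    exact hasTwoDisjointConnected_of_path hl
      (mem_of_nodup_of_length_eq_card hl (by simp [hV])) h
  rw [← coe_edgeFinset, Set.ncard_coe_finset] at hG
  obtain ⟨t, hGt, htop, ht⟩ := Finset.exists_subsuperset_card_eq
    (edgeFinset_mono (le_top : Gᶜ ≤ ⊤)) hG
    (by rw [card_edgeFinset_top_eq_card_choose_two, hV]; decide)
  obtain ⟨e₁, e₂, hne, rfl⟩ := Finset.card_eq_two.mp ht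
  induction e₁ with | _ a b
  induction e₂ with | _ c d
  have hab : a ≠ b := by simpa using htop (Finset.mem_insert_self _ _)
  have hcd : c ≠ d := by
    simpa using htop (Finset.mem_insert_of_mem (Finset.mem_singleton_self _))
  have h : ∀ x y, x ≠ y → ¬ G.Adj x y → s(x, y) = s(a, b) ∨ s(x, y) = s(c, d) := by
    intro x y hxy hadj
    have : s(x, y) ∈ Gᶜ.edgeFinset := by simp [hxy, hadj]
    simpa only [Finset.mem_insert, Finset.mem_singleton] using hGt this
  rw [ne_eq, Sym2.eq_iff] at hne
  simp only [Sym2.eq_iff] at h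
  by_cases hac : a = c
  · exact hpath a b d hab (by grind) (by grind) (by simp only [Sym2.eq_iff]; grind)
  by_cases had : a = d
  · exact hpath a b c hab (by grind) (by grind) (by simp only [Sym2.eq_iff]; grind)
  by_cases hbc : b = c
  · exact hpath b a d hab.symm (by grind) (by grind) (by simp only [Sym2.eq_iff]; grind)
  by_cases hbd : b = d
  · exact hpath b a c hab.symm (by grind) (by grind) (by simp only [Sym2.eq_iff]; grind)
  obtain ⟨e, he⟩ := exists_notMem_of_length_lt_card (l := [a, b, c, d]) (by simp [hV])
  have hl : [a, b, c, d, e].Nodup := by grind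
  exact hasTwoDisjointConnected_of_matching hl
    (mem_of_nodup_of_length_eq_card hl (by simp [hV])) (by simpa only [Sym2.eq_iff] using h)

/-- Some vertex can be deleted from `K` so that an edge of `K`, if there is one, is lost. -/
theorem exists_ncard_edgeSet_comap_le [Finite V] [Nonempty V] (K : SimpleGraph V) :
    ∃ v, (K.comap (Subtype.val : {x // x ≠ v} → V)).edgeSet.ncard ≤ K.edgeSet.ncard - 1 := by
  have himage : ∀ v, Sym2.map Subtype.val ''
      (K.comap (Subtype.val : {x // x ≠ v} → V)).edgeSet ⊆ K.edgeSet \ K.incidenceSet v := by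
    rintro v _ ⟨e, he, rfl⟩
    induction e with | _ x y
    refine ⟨he, fun hmem ↦ ?_⟩
    rcases Sym2.mem_iff.mp hmem.2 with h | h
    exacts [x.2 h.symm, y.2 h.symm]
  have hcard : ∀ v, (K.comap (Subtype.val : {x // x ≠ v} → V)).edgeSet.ncard ≤
      (K.edgeSet \ K.incidenceSet v).ncard := by
    intro v
    rw [← Set.ncard_image_of_injective _ (Sym2.map.injective Subtype.val_injective)]
    exact Set.ncard_le_ncard (himage v)
  rcases K.edgeSet.eq_empty_or_nonempty with h | ⟨e, he⟩
  · refine ⟨Classical.arbitrary V, (hcard _).trans ?_⟩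
    simp [h]
  · induction e with | _ v w
    refine ⟨v, (hcard v).trans ?_⟩
    rw [← Set.ncard_sdiff_singleton_of_mem he]
    refine Set.ncard_le_ncard (Set.sdiff_subset_sdiff_right ?_)
    rw [Set.singleton_subset_iff]
    exact ⟨he, Sym2.mem_mk_left v w⟩

theorem hasTwoDisjointConnected_of_ncard_compl {n : ℕ} (hn : 5 ≤ n) :
    ∀ {V : Type*} [Fintype V] (G : SimpleGraph V), Fintype.card V = n →
      Gᶜ.edgeSet.ncard + 3 ≤ n → G.HasTwoDisjointConnected := by
  induction n, hn using Nat.le_induction with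
  | base => exact fun G hV hG ↦ hasTwoDisjointConnected_of_card_eq_five hV (by omega)
  | succ n hn ih =>
    intro V _ G hV hG
    classical
    have : Nonempty V := Fintype.card_pos_iff.mp (by omega)
    obtain ⟨v, hv⟩ := exists_ncard_edgeSet_comap_le Gᶜ
    have hcomap : (G.comap (Subtype.val : {x // x ≠ v} → V))ᶜ =
        Gᶜ.comap (Subtype.val : {x // x ≠ v} → V) := by
      ext x y
      simp [Subtype.ext_iff]
    have hdeg : 1 < (G.neighborFinset v).card := by
      have hle := Gᶜ.degree_le_card_edgeFinset v
      rw [degree_compl, ← Set.ncard_coe_finset, coe_edgeFinset] at hle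
      rw [card_neighborFinset_eq_degree]
      omega
    obtain ⟨a, ha, b, hb, hab⟩ := Finset.one_lt_card.mp hdeg
    rw [mem_neighborFinset] at ha hb
    refine .of_comap hab ha hb (ih _ ?_ ?_)
    · simp [Fintype.card_subtype_compl, hV]
    · rw [hcomap]
      omega

theorem kappaBar_card [Fintype V] (G : SimpleGraph V) :
    G.kappaBar (Fintype.card V) = G.steinerConn Set.univ := by
  have : {m : ℕ | ∃ S : Finset V, S.card = Fintype.card V ∧ G.steinerConn ↑S = m} =
      {G.steinerConn Set.univ} := by
    ext m
    simp [Finset.card_eq_iff_eq_univ, eq_comm]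
  rw [kappaBar, this, csSup_singleton]

theorem isSteinerTree_toSubgraph {G T : SimpleGraph V} (hT : T.IsTree) (hle : T ≤ G) :
    G.IsSteinerTree Set.univ (toSubgraph T hle) := by
  refine ⟨fun x _ ↦ trivial, ?_⟩
  have e := (toSubgraph T hle).spanningCoeEquivCoeOfSpanning (toSubgraph.isSpanning T hle)
  rw [← e.isTree_iff]
  exact hT

theorem HasTwoDisjointConnected.two_le_steinerConn [Finite V] [Nontrivial V]
    {G : SimpleGraph V} (h : G.HasTwoDisjointConnected) : 2 ≤ G.steinerConn Set.univ := by
  obtain ⟨H₁, H₂, h₁, h₂, hd, hc₁, hc₂⟩ := h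
  obtain ⟨T₁, hT₁, ht₁⟩ := hc₁.exists_isTree_le
  obtain ⟨T₂, hT₂, ht₂⟩ := hc₂.exists_isTree_le
  have hdT : Disjoint T₁ T₂ := hd.mono hT₁ hT₂
  refine le_csSup ?_ ⟨![toSubgraph T₁ (hT₁.trans h₁), toSubgraph T₂ (hT₂.trans h₂)], ?_, ?_⟩
  · refine ⟨Nat.card G.Subgraph, ?_⟩
    rintro n ⟨f, hf, hdisj⟩
    have hinj : Function.Injective f := by
      intro i j hij
      by_contra hne
      have hempty := (hdisj i j hne).1
      rw [← hij, Set.inter_self] at hempty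
      obtain ⟨x, y, hxy⟩ := exists_pair_ne V
      have hx : x ∈ (f i).verts := (hf i).1 trivial
      have hy : y ∈ (f i).verts := (hf i).1 trivial
      have : Nontrivial (f i).verts := ⟨⟨x, hx⟩, ⟨y, hy⟩, by simpa using hxy⟩
      obtain ⟨z, hz⟩ := (hf i).2.connected.preconnected.exists_adj_of_nontrivial ⟨x, hx⟩
      have : s(x, z.1) ∈ (f i).edgeSet := by simpa using hz
      simp [hempty] at this
    simpa using Nat.card_le_card_of_injective f hinj
  · intro i
    fin_cases i
    · exact isSteinerTree_toSubgraph ht₁ _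
    · exact isSteinerTree_toSubgraph ht₂ _
  · have hE : T₁.edgeSet ∩ T₂.edgeSet = ∅ := by
      rw [← Set.disjoint_iff_inter_eq_empty]
      exact disjoint_edgeSet.mpr hdT
    have hE₁ : (toSubgraph T₁ (hT₁.trans h₁)).edgeSet = T₁.edgeSet := rfl
    have hE₂ : (toSubgraph T₂ (hT₂.trans h₂)).edgeSet = T₂.edgeSet := rfl
    intro i j hij
    fin_cases i <;> fin_cases j
    · exact absurd rfl hij
    · exact ⟨hE, Set.univ_inter _⟩
    · exact ⟨(Set.inter_comm _ _).trans hE, Set.univ_inter _⟩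
    · exact absurd rfl hij

theorem ncard_edgeSet_add_ncard_compl [Fintype V] (G : SimpleGraph V) :
    G.edgeSet.ncard + Gᶜ.edgeSet.ncard = (Fintype.card V).choose 2 := by
  classical
  rw [← Set.ncard_union_eq (disjoint_edgeSet.mpr disjoint_compl_right), ← edgeSet_sup,
    sup_compl_eq_top, ← card_edgeFinset_top_eq_card_choose_two, ← coe_edgeFinset,
    Set.ncard_coe_finset]

end SimpleGraph

/-- A connected graph on `n ≥ 5` vertices with `κ̄ₙ(G) = 1` has at most
`C(n-1, 2) + 1` edges. -/
theorem stmt_14 {V : Type*} [Fintype V] (G : SimpleGraph V) (hn : 5 ≤ Fintype.card V)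
    (hG : G.Connected) (hk : G.kappaBar (Fintype.card V) = 1) :
    G.edgeSet.ncard ≤ (Fintype.card V - 1).choose 2 + 1 := by
  by_contra! hlt
  have hsum := G.ncard_edgeSet_add_ncard_compl
  have hch : (Fintype.card V).choose 2 =
      (Fintype.card V - 1) + (Fintype.card V - 1).choose 2 := by
    obtain ⟨m, hm⟩ : ∃ m, Fintype.card V = m + 1 := ⟨Fintype.card V - 1, by omega⟩
    rw [hm, Nat.choose_succ_succ' m 1]
    simp
  have : Nontrivial V := Fintype.one_lt_card_iff_nontrivial.mp (by omega)
  have h := (hasTwoDisjointConnected_of_ncard_compl hn G rfl (by omega)).two_le_steinerConn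
  rw [← kappaBar_card] at h
  omega
end
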